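/- Let v0 and ṽ0 be functions in H^{s+1}_0(T) with norms at most R, and suppose their Miura transforms agree at frequencies |k| ≤ N': P_{≤N'}(M ṽ0 - M v0) = 0, where M v = v_x + v^2 - P_0(v^2) and P_{≤N'} is the sharp Fourier projection onto frequencies |k| ≤ N'. Then there exist σ > 0 and C = C(s, R) such that ||P_{≤N'}(ṽ0 - v0)||_{H^{s+1}_0} ≤ C (N')^{-σ}, for s ≥ -1/2. -/

import Mathlib

/-! Mean-zero real functions on the circle are represented by Fourier coefficient
sequences `a : ℤ → ℂ` with `a 0 = 0` and `a (-k) = conj (a k)`.  The Miura transform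
`M v = v_x + v² - P₀(v²)` acts by `(M a) k = i k a k + (a ⋆ a) k` for `k ≠ 0`. -/

/-- The `H^s(𝕋)` norm on the Fourier side. -/
noncomputable def hsNorm (s : ℝ) (a : ℤ → ℂ) : ℝ :=
  Real.sqrt (∑' k : ℤ, (1 + (k : ℝ) ^ 2) ^ s * ‖a k‖ ^ 2)

/-- Membership in `H^s(𝕋)`. -/
def InHs (s : ℝ) (a : ℤ → ℂ) : Prop :=
  Summable fun k : ℤ => (1 + (k : ℝ) ^ 2) ^ s * ‖a k‖ ^ 2

/-- The sequence is the Fourier transform of a real-valued function. -/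
def IsRealSeq (a : ℤ → ℂ) : Prop := ∀ k, a (-k) = starRingEnd ℂ (a k)

/-- Convolution of Fourier coefficient sequences. -/
noncomputable def seqConv (a b : ℤ → ℂ) (k : ℤ) : ℂ := ∑' j : ℤ, a j * b (k - j)

/-- The Miura transform on the Fourier side. -/
noncomputable def miura (a : ℤ → ℂ) (k : ℤ) : ℂ :=
  if k = 0 then 0 else Complex.I * (k : ℂ) * a k + seqConv a a k

section

open Real intervalIntegral

/-- Sup bound for a mean-zero periodic solution of `z' + p z = c - p G` with an arbitrary
constant `c`, obtained from the integrating factor `e^P`, `P' = p`. -/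
lemma norm_le_of_periodic_linear_ode {P p : ℝ → ℝ} {z G : ℝ → ℂ} {c : ℂ} {B D g : ℝ}
    (hP : ∀ x, HasDerivAt P (p x) x) (hp : Continuous p) (hG : Continuous G)
    (hz : ∀ x, HasDerivAt z (c - p x * z x - p x * G x) x)
    (hPper : P (2 * π) = P 0) (hzper : z (2 * π) = z 0)
    (hB : ∀ x, |P x| ≤ B) (hg : ∀ x, ‖G x‖ ≤ g) (hD : ∫ x in (0 : ℝ)..2 * π, |p x| ≤ D)
    (hmean : ∫ x in (0 : ℝ)..2 * π, z x = 0) {x : ℝ} (hx0 : 0 ≤ x) (hx1 : x ≤ 2 * π) :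
    ‖z x‖ ≤ exp B * ((exp (2 * B) + 1) * ((exp (3 * B) + exp B) * (g * D))) := by
  have hPc : Continuous P := continuous_iff_continuousAt.2 fun x => (hP x).continuousAt
  have hzc : Continuous z := continuous_iff_continuousAt.2 fun x => (hz x).continuousAt
  have h2pi : (0 : ℝ) ≤ 2 * π := by positivity
  have hg0 : 0 ≤ g := (norm_nonneg _).trans (hg 0)
  have heP : ∀ x, exp (P x) ≤ exp B := fun x => exp_le_exp.2 (le_of_abs_le (hB x))
  have heP' : ∀ x, exp (-P x) ≤ exp B := fun x => exp_le_exp.2 (neg_le.1 (neg_le_of_abs_le (hB x)))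
  have heB : ∀ x, exp (-B) ≤ exp (P x) := fun x => exp_le_exp.2 (neg_le_of_abs_le (hB x))
  have heB' : ∀ x, exp (-B) ≤ exp (-P x) := fun x =>
    exp_le_exp.2 (by have := le_of_abs_le (hB x); linarith)
  have low : ∀ Q : ℝ → ℝ, Continuous Q → (∀ x, exp (-B) ≤ exp (Q x)) → ∀ d : ℂ,
      ‖d‖ * (2 * π * exp (-B)) ≤ ‖d * ∫ x in (0 : ℝ)..2 * π, ((exp (Q x) : ℝ) : ℂ)‖ := by
    intro Q hQ hQB d
    rw [norm_mul, intervalIntegral.integral_ofReal, Complex.norm_real]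
    refine mul_le_mul_of_nonneg_left (le_trans ?_ (le_abs_self _)) (norm_nonneg _)
    calc 2 * π * exp (-B) = ∫ x in (0 : ℝ)..2 * π, exp (-B) := by simp
      _ ≤ _ := integral_mono_on h2pi (by simp)
        ((by fun_prop : Continuous fun x => exp (Q x)).intervalIntegrable _ _) (fun x _ => hQB x)
  set y : ℝ → ℂ := fun x => (exp (P x) : ℝ) * z x with hy
  have hyd : ∀ x, HasDerivAt y (c * (exp (P x) : ℝ) - (exp (P x) : ℝ) * (p x * G x)) x := by
    intro x
    have h1 := ((hP x).exp.ofReal_comp).mul (hz x)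
    refine h1.congr_deriv ?_
    push_cast
    ring
  have hcont1 : Continuous fun x => c * ((exp (P x) : ℝ) : ℂ) := by fun_prop
  have hcont2 : Continuous fun x => ((exp (P x) : ℝ) : ℂ) * (p x * G x) := by fun_prop
  have hftc : ∀ x, y x - y 0 = (∫ s in (0 : ℝ)..x, c * ((exp (P s) : ℝ) : ℂ)) -
      ∫ s in (0 : ℝ)..x, ((exp (P s) : ℝ) : ℂ) * (p s * G s) := by
    intro x
    rw [← integral_sub (hcont1.intervalIntegrable _ _) (hcont2.intervalIntegrable _ _)]
    exact (integral_eq_sub_of_hasDerivAt (fun s _ => hyd s)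
      ((hcont1.sub hcont2).intervalIntegrable _ _)).symm
  have hsrc : ∀ x, 0 ≤ x → x ≤ 2 * π →
      ‖∫ s in (0 : ℝ)..x, ((exp (P s) : ℝ) : ℂ) * (p s * G s)‖ ≤ exp B * (g * D) := by
    intro x hx0 hx1
    have habs : Continuous fun s => |p s| := hp.abs
    calc ‖∫ s in (0 : ℝ)..x, ((exp (P s) : ℝ) : ℂ) * (p s * G s)‖
        ≤ ∫ s in (0 : ℝ)..x, exp B * g * |p s| := by
          refine norm_integral_le_of_norm_le hx0 (Filter.Eventually.of_forall fun s _ => ?_)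
            ((continuous_const.mul habs).intervalIntegrable _ _)
          rw [norm_mul, norm_mul, Complex.norm_real, Complex.norm_real, Real.norm_eq_abs,
            Real.norm_eq_abs, abs_of_pos (exp_pos _)]
          calc exp (P s) * (|p s| * ‖G s‖) ≤ exp B * (|p s| * g) := by
                exact mul_le_mul (heP s) (by gcongr; exact hg s) (by positivity) (exp_pos _).le
            _ = _ := by ring
      _ ≤ ∫ s in (0 : ℝ)..2 * π, exp B * g * |p s| :=
          integral_mono_interval le_rfl hx0 hx1
            (Filter.Eventually.of_forall fun s => by simp only [Pi.zero_apply]; positivity)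
            ((continuous_const.mul habs).intervalIntegrable _ _)
      _ = exp B * g * ∫ s in (0 : ℝ)..2 * π, |p s| := by rw [integral_const_mul]
      _ ≤ exp B * g * D := by gcongr
      _ = _ := by ring
  have hper : y (2 * π) = y 0 := by simp only [hy, hPper, hzper]
  have hc : ‖c‖ * (2 * π) ≤ exp (2 * B) * (g * D) := by
    have h1 := hftc (2 * π)
    rw [hper, sub_self, integral_const_mul] at h1
    have h2 := low P hPc heB c
    rw [sub_eq_zero.1 h1.symm] at h2
    have h3 := h2.trans (hsrc _ h2pi le_rfl)
    calc ‖c‖ * (2 * π) = ‖c‖ * (2 * π * exp (-B)) * exp B := by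
          rw [exp_neg]; field_simp
      _ ≤ exp B * (g * D) * exp B := by gcongr
      _ = _ := by rw [two_mul, exp_add]; ring
  have hyx : ∀ x, 0 ≤ x → x ≤ 2 * π → ‖y x - y 0‖ ≤ (exp (3 * B) + exp B) * (g * D) := by
    intro x hx0 hx1
    rw [hftc x]
    refine (norm_sub_le _ _).trans ?_
    have h1 : ‖∫ s in (0 : ℝ)..x, c * ((exp (P s) : ℝ) : ℂ)‖ ≤ ‖c‖ * exp B * |x - 0| := by
      refine norm_integral_le_of_norm_le_const fun s _ => ?_
      rw [norm_mul, Complex.norm_real, Real.norm_eq_abs, abs_of_pos (exp_pos _)]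
      exact mul_le_mul_of_nonneg_left (heP s) (norm_nonneg _)
    rw [sub_zero, abs_of_nonneg hx0] at h1
    have h2 : ‖c‖ * exp B * x ≤ exp (3 * B) * (g * D) := by
      calc ‖c‖ * exp B * x ≤ ‖c‖ * exp B * (2 * π) := by gcongr
        _ = (‖c‖ * (2 * π)) * exp B := by ring
        _ ≤ exp (2 * B) * (g * D) * exp B := by gcongr
        _ = _ := by rw [show 3 * B = 2 * B + B by ring, exp_add]; ring
    linarith [hsrc x hx0 hx1]
  set K := (exp (3 * B) + exp B) * (g * D) with hK
  have hzy : ∀ x, z x = y 0 * ((exp (-P x) : ℝ) : ℂ) + ((exp (-P x) : ℝ) : ℂ) * (y x - y 0) := by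
    intro x
    have : ((exp (-P x) : ℝ) : ℂ) * ((exp (P x) : ℝ) : ℂ) = 1 := by
      rw [← Complex.ofReal_mul, ← exp_add]; simp
    calc z x = (((exp (-P x) : ℝ) : ℂ) * ((exp (P x) : ℝ) : ℂ)) * z x := by rw [this, one_mul]
      _ = _ := by simp only [hy]; ring
  have hyc : Continuous y := by fun_prop
  have hrem : ∀ x, 0 ≤ x → x ≤ 2 * π → ‖((exp (-P x) : ℝ) : ℂ) * (y x - y 0)‖ ≤ exp B * K := by
    intro x hx0 hx1
    rw [norm_mul, Complex.norm_real, Real.norm_eq_abs, abs_of_pos (exp_pos _)]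
    exact mul_le_mul (heP' x) (hyx x hx0 hx1) (norm_nonneg _) (exp_pos _).le
  have hy0 : ‖y 0‖ ≤ exp (2 * B) * K := by
    have h1 : (y 0 * ∫ x in (0 : ℝ)..2 * π, ((exp (-P x) : ℝ) : ℂ)) =
        -∫ x in (0 : ℝ)..2 * π, ((exp (-P x) : ℝ) : ℂ) * (y x - y 0) := by
      rw [eq_neg_iff_add_eq_zero, ← integral_const_mul, ← integral_add
        ((by fun_prop : Continuous fun x => y 0 * ((exp (-P x) : ℝ) : ℂ)).intervalIntegrable _ _)
        ((by fun_prop : Continuous fun x =>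
          ((exp (-P x) : ℝ) : ℂ) * (y x - y 0)).intervalIntegrable _ _), ← hmean]
      exact integral_congr fun x _ => (hzy x).symm
    have h2 := low (fun x => -P x) hPc.neg heB' (y 0)
    rw [h1, norm_neg] at h2
    have h3 : ‖∫ x in (0 : ℝ)..2 * π, ((exp (-P x) : ℝ) : ℂ) * (y x - y 0)‖ ≤
        exp B * K * |2 * π - 0| := by
      refine norm_integral_le_of_norm_le_const fun s hs => ?_
      rw [Set.uIoc_of_le h2pi] at hs
      exact hrem s hs.1.le hs.2
    rw [sub_zero, abs_of_nonneg h2pi] at h3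
    have h4 : ‖y 0‖ * exp (-B) ≤ exp B * K := by
      refine le_of_mul_le_mul_right ?_ (by positivity : 0 < 2 * π)
      linarith
    calc ‖y 0‖ = ‖y 0‖ * exp (-B) * exp B := by rw [exp_neg]; field_simp
      _ ≤ exp B * K * exp B := by gcongr
      _ = _ := by rw [two_mul, exp_add]; ring
  rw [hzy x]
  refine (norm_add_le _ _).trans ?_
  have h1 : ‖y 0 * ((exp (-P x) : ℝ) : ℂ)‖ ≤ exp (2 * B) * K * exp B := by
    rw [norm_mul, Complex.norm_real, Real.norm_eq_abs, abs_of_pos (exp_pos _)]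
    exact mul_le_mul hy0 (heP' x) (exp_pos _).le ((norm_nonneg _).trans hy0)
  linarith [hrem x hx0 hx1]

open Complex in
/-- The trigonometric polynomial with coefficients `a` and frequencies in `S`. -/
noncomputable def trigPoly (S : Finset ℤ) (a : ℤ → ℂ) (x : ℝ) : ℂ :=
  ∑ k ∈ S, a k * cexp (I * k * x)

lemma hasDerivAt_trigPoly (S : Finset ℤ) (a : ℤ → ℂ) (x : ℝ) :
    HasDerivAt (trigPoly S a) (trigPoly S (fun k => Complex.I * k * a k) x) x := by
  unfold trigPoly
  refine HasDerivAt.fun_sum fun k _ => ?_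
  have h : HasDerivAt (fun y : ℝ => Complex.I * k * (y : ℂ)) (Complex.I * k * 1) x :=
    (Complex.ofRealCLM.hasDerivAt (x := x)).const_mul _
  refine (h.cexp.const_mul (a k)).congr_deriv ?_
  ring

lemma continuous_trigPoly (S : Finset ℤ) (a : ℤ → ℂ) : Continuous (trigPoly S a) := by
  unfold trigPoly
  fun_prop

lemma trigPoly_two_pi (S : Finset ℤ) (a : ℤ → ℂ) : trigPoly S a (2 * π) = trigPoly S a 0 := by
  refine Finset.sum_congr rfl fun k _ => ?_
  have : Complex.I * k * ((2 * π : ℝ) : ℂ) = k * (2 * π * Complex.I) := by push_cast; ring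
  rw [this, Complex.exp_int_mul_two_pi_mul_I]
  simp

lemma norm_exp_I_mul_int_mul (k : ℤ) (x : ℝ) : ‖Complex.exp (Complex.I * k * x)‖ = 1 := by
  have : Complex.I * k * x = ((k * x : ℝ) : ℂ) * Complex.I := by push_cast; ring
  rw [this, Complex.norm_exp_ofReal_mul_I]

lemma norm_trigPoly_le (S : Finset ℤ) (a : ℤ → ℂ) (x : ℝ) :
    ‖trigPoly S a x‖ ≤ ∑ k ∈ S, ‖a k‖ := by
  refine (norm_sum_le _ _).trans (Finset.sum_le_sum fun k _ => ?_)
  rw [norm_mul, norm_exp_I_mul_int_mul, mul_one]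

lemma integral_exp_I_mul_int_mul (n : ℤ) :
    ∫ x in (0 : ℝ)..2 * π, Complex.exp (Complex.I * n * x) = if n = 0 then 2 * (π : ℂ) else 0 := by
  split_ifs with h
  · simp [h]
  · have hn : Complex.I * n ≠ 0 := mul_ne_zero Complex.I_ne_zero (by exact_mod_cast h)
    have h2 : Complex.I * n * ((2 * π : ℝ) : ℂ) = n * (2 * π * Complex.I) := by push_cast; ring
    rw [integral_exp_mul_complex hn, h2, Complex.exp_int_mul_two_pi_mul_I]
    simp

lemma integral_trigPoly_mul_exp (S : Finset ℤ) (a : ℤ → ℂ) (m : ℤ) :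
    ∫ x in (0 : ℝ)..2 * π, trigPoly S a x * Complex.exp (Complex.I * (-m : ℤ) * x) =
      if m ∈ S then 2 * π * a m else 0 := by
  have h : ∀ x : ℝ, trigPoly S a x * Complex.exp (Complex.I * (-m : ℤ) * x) =
      ∑ k ∈ S, a k * Complex.exp (Complex.I * (k - m : ℤ) * x) := by
    intro x
    rw [trigPoly, Finset.sum_mul]
    refine Finset.sum_congr rfl fun k _ => ?_
    rw [mul_assoc, ← Complex.exp_add]
    push_cast
    ring_nf
  simp_rw [h]
  rw [integral_finsetSum fun k _ => (by fun_prop : Continuous fun x : ℝ =>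
    a k * Complex.exp (Complex.I * (k - m : ℤ) * x)).intervalIntegrable _ _]
  simp_rw [integral_const_mul, integral_exp_I_mul_int_mul, sub_eq_zero, mul_ite, mul_zero]
  rw [Finset.sum_ite_eq' S m]
  simp only [mul_comm]

lemma integral_trigPoly (S : Finset ℤ) (a : ℤ → ℂ) (h0 : a 0 = 0) :
    ∫ x in (0 : ℝ)..2 * π, trigPoly S a x = 0 := by
  simpa [h0] using integral_trigPoly_mul_exp S a 0

lemma integral_norm_sq_trigPoly (S : Finset ℤ) (a : ℤ → ℂ) :
    ∫ x in (0 : ℝ)..2 * π, ‖trigPoly S a x‖ ^ 2 = 2 * π * ∑ k ∈ S, ‖a k‖ ^ 2 := by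
  have h : ∀ x : ℝ, ((‖trigPoly S a x‖ ^ 2 : ℝ) : ℂ) = ∑ k ∈ S, (starRingEnd ℂ (a k)) *
      (trigPoly S a x * Complex.exp (Complex.I * (-k : ℤ) * x)) := by
    intro x
    push_cast
    rw [← Complex.mul_conj']
    conv_lhs => rw [show (starRingEnd ℂ) (trigPoly S a x) = ∑ k ∈ S, (starRingEnd ℂ (a k)) *
      Complex.exp (Complex.I * (-k : ℤ) * x) from by
        rw [trigPoly, map_sum]
        refine Finset.sum_congr rfl fun k _ => ?_
        rw [map_mul, ← Complex.exp_conj]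
        simp]
    rw [Finset.mul_sum]
    exact Finset.sum_congr rfl fun k _ => by push_cast; ring
  have hc := continuous_trigPoly S a
  apply Complex.ofReal_injective
  rw [← intervalIntegral.integral_ofReal]
  simp_rw [h]
  rw [integral_finsetSum fun k _ => (by fun_prop : Continuous fun x : ℝ => (starRingEnd ℂ (a k)) *
      (trigPoly S a x * Complex.exp (Complex.I * (-k : ℤ) * x))).intervalIntegrable _ _]
  simp_rw [integral_const_mul, integral_trigPoly_mul_exp]
  push_cast
  rw [Finset.mul_sum]
  refine Finset.sum_congr rfl fun k hk => ?_
  rw [if_pos hk, ← Complex.mul_conj']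
  ring

lemma trigPoly_eq_ofReal_re {S : Finset ℤ} (hS : ∀ k ∈ S, -k ∈ S) {a : ℤ → ℂ} (ha : IsRealSeq a)
    (x : ℝ) : ((trigPoly S a x).re : ℂ) = trigPoly S a x := by
  rw [← Complex.conj_eq_iff_re, trigPoly, map_sum]
  refine Finset.sum_nbij' (fun k => -k) (fun k => -k) hS hS (by simp) (by simp) fun k _ => ?_
  rw [map_mul, ← Complex.exp_conj, ha k]
  simp

/-- Bound for the low frequencies of a mean-zero solution of `u' + p u = c + G'`, in terms
of `G` and with a constant depending only on norms of `p`. -/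
lemma norm_coeff_le_of_trigPoly_ode {S T : Finset ℤ} (hS : ∀ k ∈ S, -k ∈ S) {p u G : ℤ → ℂ} {c : ℂ}
    {B Q g : ℝ} (hp : IsRealSeq p) (hp0 : p 0 = 0) (hu0 : u 0 = 0) (hG0 : G 0 = 0)
    (heq : ∀ x, trigPoly S (fun k => Complex.I * k * u k) x + trigPoly S p x * trigPoly S u x =
      c + trigPoly T (fun k => Complex.I * k * G k) x)
    (hB : ∑ k ∈ S, ‖p k / (Complex.I * k)‖ ≤ B) (hQ : ∑ k ∈ S, ‖p k‖ ^ 2 ≤ Q)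
    (hg : ∑ k ∈ T, ‖G k‖ ≤ g) {k : ℤ} (hk : k ∈ S) :
    ‖u k‖ ≤ (exp B * ((exp (2 * B) + 1) * ((exp (3 * B) + exp B) * (π * (1 + Q)))) + 1) * g := by
  have hpi := Real.pi_pos
  have hpc := continuous_trigPoly S p
  have hpr := trigPoly_eq_ofReal_re hS hp
  set P : ℤ → ℂ := fun k => p k / (Complex.I * k) with hPdef
  have hderiv : (fun k : ℤ => Complex.I * k * P k) = p := by
    funext k
    rcases eq_or_ne k 0 with rfl | hk
    · simp [hp0]
    · have : (k : ℂ) ≠ 0 := by exact_mod_cast hk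
      simp only [hPdef]
      field_simp
  have hPd : ∀ x, HasDerivAt (fun x => (trigPoly S P x).re) (trigPoly S p x).re x := by
    intro x
    have := hasDerivAt_trigPoly S P x
    rw [hderiv] at this
    exact (Complex.reCLM.hasFDerivAt.comp_hasDerivAt x this)
  have hz : ∀ x, HasDerivAt (fun x => trigPoly S u x - trigPoly T G x)
      (c - ((trigPoly S p x).re : ℝ) * (trigPoly S u x - trigPoly T G x) -
        ((trigPoly S p x).re : ℝ) * trigPoly T G x) x := by
    intro x
    refine ((hasDerivAt_trigPoly S u x).sub (hasDerivAt_trigPoly T G x)).congr_deriv ?_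
    rw [hpr]
    linear_combination heq x
  have hD : ∫ x in (0 : ℝ)..2 * π, |(trigPoly S p x).re| ≤ π * (1 + Q) := by
    calc ∫ x in (0 : ℝ)..2 * π, |(trigPoly S p x).re|
        ≤ ∫ x in (0 : ℝ)..2 * π, (1 / 2 + 1 / 2 * ‖trigPoly S p x‖ ^ 2) := by
          refine integral_mono_on (by positivity)
            ((by fun_prop : Continuous fun x => |(trigPoly S p x).re|).intervalIntegrable _ _)
            ((by fun_prop : Continuous fun x =>
              1 / 2 + 1 / 2 * ‖trigPoly S p x‖ ^ 2).intervalIntegrable _ _) fun x _ => ?_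
          have := Complex.abs_re_le_norm (trigPoly S p x)
          nlinarith [sq_nonneg (‖trigPoly S p x‖ - 1)]
      _ = π * (1 + ∑ k ∈ S, ‖p k‖ ^ 2) := by
          rw [integral_add (by simp) ((by fun_prop : Continuous fun x =>
              1 / 2 * ‖trigPoly S p x‖ ^ 2).intervalIntegrable _ _), integral_const_mul,
            integral_norm_sq_trigPoly]
          simp
          ring
      _ ≤ _ := by gcongr
  have hmain : ∀ x, 0 ≤ x → x ≤ 2 * π → ‖trigPoly S u x‖ ≤
      (exp B * ((exp (2 * B) + 1) * ((exp (3 * B) + exp B) * (π * (1 + Q)))) + 1) * g := by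
    intro x hx0 hx1
    have h1 := norm_le_of_periodic_linear_ode hPd (Complex.continuous_re.comp hpc)
      (continuous_trigPoly T G) hz (by simp only [trigPoly_two_pi]) (by simp only [trigPoly_two_pi])
      (fun x => (Complex.abs_re_le_norm _).trans ((norm_trigPoly_le S P x).trans hB))
      (fun x => (norm_trigPoly_le T G x).trans hg) hD
      (by rw [integral_sub ((continuous_trigPoly S u).intervalIntegrable _ _)
            ((continuous_trigPoly T G).intervalIntegrable _ _), integral_trigPoly S u hu0,
            integral_trigPoly T G hG0, sub_zero]) hx0 hx1
    have h2 := (norm_trigPoly_le T G x).trans hg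
    have h3 : ‖trigPoly S u x‖ ≤ ‖trigPoly S u x - trigPoly T G x‖ + ‖trigPoly T G x‖ := by
      simpa using norm_add_le (trigPoly S u x - trigPoly T G x) (trigPoly T G x)
    linarith
  have h4 := integral_trigPoly_mul_exp S u k
  rw [if_pos hk] at h4
  have h5 := norm_integral_le_of_norm_le_const (a := 0) (b := 2 * π)
    (f := fun x : ℝ => trigPoly S u x * Complex.exp (Complex.I * (-k : ℤ) * x))
    (C := (exp B * ((exp (2 * B) + 1) * ((exp (3 * B) + exp B) * (π * (1 + Q)))) + 1) * g)
    fun x hx => by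
      rw [Set.uIoc_of_le (by positivity)] at hx
      rw [norm_mul, norm_exp_I_mul_int_mul, mul_one]
      exact hmain x hx.1.le hx.2
  rw [h4, sub_zero, abs_of_pos (by positivity : 0 < 2 * π), norm_mul] at h5
  have h6 : ‖(2 * π : ℂ)‖ = 2 * π := by simp [abs_of_pos hpi]
  rw [h6, mul_comm] at h5
  exact le_of_mul_le_mul_right h5 (by positivity)

/-- The squared Japanese bracket `⟨k⟩² = 1 + k²`. -/
noncomputable def sqBracket (k : ℤ) : ℝ := 1 + (k : ℝ) ^ 2

lemma one_le_sqBracket (k : ℤ) : 1 ≤ sqBracket k := by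
  unfold sqBracket
  nlinarith [sq_nonneg (k : ℝ)]

lemma sqBracket_pos (k : ℤ) : 0 < sqBracket k := one_pos.trans_le (one_le_sqBracket k)

lemma sqBracket_le_mul (j k : ℤ) : sqBracket k ≤ 2 * (sqBracket j * sqBracket (k - j)) := by
  unfold sqBracket
  push_cast
  nlinarith [sq_nonneg ((j : ℝ) - (k - j)), mul_nonneg (sq_nonneg (j : ℝ)) (sq_nonneg ((k : ℝ) - j))]

lemma sq_le_sqBracket {N : ℝ} (hN : 0 ≤ N) {k : ℤ} (hk : ¬|(k : ℝ)| ≤ N) :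
    N ^ 2 ≤ sqBracket k := by
  unfold sqBracket
  have : N ^ 2 ≤ |(k : ℝ)| ^ 2 := by gcongr; exact (not_le.1 hk).le
  rw [sq_abs] at this
  linarith

lemma one_le_abs_intCast {k : ℤ} (hk : k ≠ 0) : 1 ≤ |(k : ℝ)| := by
  exact_mod_cast Int.one_le_abs hk

lemma inv_abs_le_sqBracket {k : ℤ} (hk : k ≠ 0) :
    |(k : ℝ)|⁻¹ ≤ 2 * sqBracket k ^ (-(1 / 2) : ℝ) := by
  have h1 := one_le_abs_intCast hk
  have h2 : sqBracket k ≤ (2 * |(k : ℝ)|) ^ 2 := by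
    unfold sqBracket
    rw [mul_pow, sq_abs]
    nlinarith [sq_abs (k : ℝ)]
  have h3 : sqBracket k ^ (1 / 2 : ℝ) ≤ 2 * |(k : ℝ)| := by
    rw [← Real.sqrt_eq_rpow]
    exact (Real.sqrt_le_left (by positivity)).2 h2
  have h4 := Real.rpow_pos_of_pos (sqBracket_pos k) (1 / 2)
  rw [Real.rpow_neg (sqBracket_pos k).le, inv_le_comm₀ (by positivity) (by positivity),
    mul_inv, inv_inv]
  linarith

lemma summable_sqBracket_rpow {q : ℝ} (hq : 1 / 2 < q) :
    Summable fun k : ℤ => sqBracket k ^ (-q) := by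
  refine Summable.of_norm_bounded_eventually (Real.summable_abs_int_rpow (b := 2 * q) (by linarith))
    ((Set.finite_singleton (0 : ℤ)).subset fun k hk => ?_)
  by_contra h0
  refine hk ?_
  have h1 := one_le_abs_intCast h0
  change ‖sqBracket k ^ (-q)‖ ≤ |(k : ℝ)| ^ (-(2 * q))
  rw [Real.norm_eq_abs, abs_of_nonneg (Real.rpow_nonneg (sqBracket_pos k).le _),
    show -(2 * q) = 2 * -q by ring, Real.rpow_mul (abs_nonneg _)]
  refine Real.rpow_le_rpow_of_nonpos (by positivity) ?_ (by linarith)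
  rw [Real.rpow_two, sq_abs, sqBracket]
  linarith

/-- The sequence `a` has `H^r` norm at most `A`. -/
def HsBound (r : ℝ) (a : ℤ → ℂ) (A : ℝ) : Prop :=
  0 ≤ A ∧ (Summable fun k : ℤ => sqBracket k ^ r * ‖a k‖ ^ 2) ∧
    ∑' k : ℤ, sqBracket k ^ r * ‖a k‖ ^ 2 ≤ A ^ 2

lemma HsBound.of_hsNorm_le {r R : ℝ} {a : ℤ → ℂ} (h : InHs r a) (hR : hsNorm r a ≤ R) :
    HsBound r a R :=
  ⟨(Real.sqrt_nonneg _).trans hR, h, (Real.sqrt_le_left ((Real.sqrt_nonneg _).trans hR)).1 hR⟩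

lemma HsBound.hsNorm_le {r A : ℝ} {a : ℤ → ℂ} (h : HsBound r a A) : hsNorm r a ≤ A :=
  (Real.sqrt_le_left h.1).2 h.2.2

lemma HsBound.of_le {r A : ℝ} {a : ℤ → ℂ} {f : ℤ → ℝ} (hA : 0 ≤ A)
    (h : ∀ k, sqBracket k ^ r * ‖a k‖ ^ 2 ≤ f k) (hf : Summable f) (hfA : ∑' k, f k ≤ A ^ 2) :
    HsBound r a A := by
  have hs : Summable fun k : ℤ => sqBracket k ^ r * ‖a k‖ ^ 2 :=
    hf.of_nonneg_of_le (fun k => mul_nonneg (Real.rpow_nonneg (sqBracket_pos k).le _)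
      (sq_nonneg _)) h
  exact ⟨hA, hs, (hs.tsum_le_tsum h hf).trans hfA⟩

lemma HsBound.of_norm_le {r t A : ℝ} {a b : ℤ → ℂ} (h : HsBound t a A) (hrt : r ≤ t)
    (hb : ∀ k, ‖b k‖ ≤ ‖a k‖) : HsBound r b A := by
  refine HsBound.of_le h.1 (fun k => ?_) h.2.1 h.2.2
  exact mul_le_mul (Real.rpow_le_rpow_of_exponent_le (one_le_sqBracket k) hrt)
    (by gcongr; exact hb k) (sq_nonneg _) (Real.rpow_nonneg (sqBracket_pos k).le _)

lemma HsBound.of_norm_le_add {r A : ℝ} {a b c : ℤ → ℂ} (ha : HsBound r a A) (hb : HsBound r b A)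
    (hc : ∀ k, ‖c k‖ ≤ ‖a k‖ + ‖b k‖) : HsBound r c (2 * A) := by
  refine HsBound.of_le (f := fun k => 2 * (sqBracket k ^ r * ‖a k‖ ^ 2) +
    2 * (sqBracket k ^ r * ‖b k‖ ^ 2)) (by linarith [ha.1]) (fun k => ?_)
    ((ha.2.1.mul_left 2).add (hb.2.1.mul_left 2)) ?_
  · have h1 := Real.rpow_nonneg (sqBracket_pos k).le r
    have h2 : ‖c k‖ ^ 2 ≤ 2 * ‖a k‖ ^ 2 + 2 * ‖b k‖ ^ 2 := by
      have : ‖c k‖ ^ 2 ≤ (‖a k‖ + ‖b k‖) ^ 2 := by gcongr; exact hc k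
      nlinarith [sq_nonneg (‖a k‖ - ‖b k‖)]
    nlinarith [mul_le_mul_of_nonneg_left h2 h1]
  · rw [(ha.2.1.mul_left 2).tsum_add (hb.2.1.mul_left 2), tsum_mul_left, tsum_mul_left]
    linarith [ha.2.2, hb.2.2]

/-- Products of `H^r` functions, `r ≥ 0`, have Fourier coefficients decaying like `⟨k⟩^{-r}`. -/
lemma HsBound.seqConv {r A B : ℝ} (hr : 0 ≤ r) {a b : ℤ → ℂ} (ha : HsBound r a A)
    (hb : HsBound r b B) (k : ℤ) : (Summable fun j => a j * b (k - j)) ∧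
      ‖seqConv a b k‖ ≤ 2 ^ (r / 2) * (A * B) * sqBracket k ^ (-(r / 2)) := by
  have hJ := fun j => Real.rpow_pos_of_pos (sqBracket_pos j) (r / 2)
  set f : ℤ → ℝ := fun j => sqBracket j ^ (r / 2) * ‖a j‖ with hf
  set g : ℤ → ℝ := fun j => sqBracket (k - j) ^ (r / 2) * ‖b (k - j)‖ with hg
  have hsq : ∀ (j : ℤ) (x : ℝ), (sqBracket j ^ (r / 2) * x) ^ (2 : ℝ) = sqBracket j ^ r * x ^ 2 := by
    intro j x
    rw [Real.rpow_two, mul_pow, ← Real.rpow_natCast, ← Real.rpow_mul (sqBracket_pos j).le]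
    norm_num
  have hfs : HasSum (fun j => f j ^ (2 : ℝ)) (∑' j, sqBracket j ^ r * ‖a j‖ ^ 2) := by
    simp only [hf, hsq]; exact ha.2.1.hasSum
  have hgs : HasSum (fun j => g j ^ (2 : ℝ)) (∑' j, sqBracket j ^ r * ‖b j‖ ^ 2) := by
    simp only [hg, hsq]
    exact (Equiv.subLeft k).hasSum_iff.2 hb.2.1.hasSum
  have hf0 : ∀ j, 0 ≤ f j := fun j => mul_nonneg (hJ j).le (norm_nonneg _)
  have hg0 : ∀ j, 0 ≤ g j := fun j => mul_nonneg (hJ _).le (norm_nonneg _)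
  have h22 : (2 : ℝ).HolderConjugate 2 := Real.HolderConjugate.two_two
  have hsum : Summable fun j => f j * g j :=
    Real.summable_mul_of_Lp_Lq_of_nonneg h22 hf0 hg0 hfs.summable hgs.summable
  have hcs := Real.inner_le_Lp_mul_Lq_tsum_of_nonneg h22 hf0 hg0 hfs.summable hgs.summable
  rw [hfs.tsum_eq, hgs.tsum_eq, ← Real.sqrt_eq_rpow, ← Real.sqrt_eq_rpow] at hcs
  have hAB : ∑' j, f j * g j ≤ A * B := hcs.trans (mul_le_mul
    ((Real.sqrt_le_left ha.1).2 ha.2.2) ((Real.sqrt_le_left hb.1).2 hb.2.2) (Real.sqrt_nonneg _) ha.1)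
  have hpt : ∀ j, ‖a j * b (k - j)‖ ≤ 2 ^ (r / 2) * sqBracket k ^ (-(r / 2)) * (f j * g j) := by
    intro j
    have h1 : sqBracket k ^ (r / 2) ≤
        2 ^ (r / 2) * (sqBracket j ^ (r / 2) * sqBracket (k - j) ^ (r / 2)) := by
      rw [← Real.mul_rpow (sqBracket_pos _).le (sqBracket_pos _).le, ← Real.mul_rpow (by norm_num)
        (mul_pos (sqBracket_pos _) (sqBracket_pos _)).le]
      exact Real.rpow_le_rpow (sqBracket_pos k).le (sqBracket_le_mul j k) (by linarith)
    rw [norm_mul, Real.rpow_neg (sqBracket_pos k).le]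
    have h2 := hJ k
    have h3 : 0 ≤ ‖a j‖ * ‖b (k - j)‖ := by positivity
    calc ‖a j‖ * ‖b (k - j)‖ = (sqBracket k ^ (r / 2))⁻¹ *
          (sqBracket k ^ (r / 2) * (‖a j‖ * ‖b (k - j)‖)) := by field_simp
      _ ≤ (sqBracket k ^ (r / 2))⁻¹ * (2 ^ (r / 2) * (sqBracket j ^ (r / 2) *
          sqBracket (k - j) ^ (r / 2)) * (‖a j‖ * ‖b (k - j)‖)) := by gcongr
      _ = _ := by simp only [hf, hg]; ring
  have hsum' := hsum.mul_left (2 ^ (r / 2) * sqBracket k ^ (-(r / 2)))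
  refine ⟨Summable.of_norm_bounded hsum' hpt, ?_⟩
  refine (tsum_of_norm_bounded hsum'.hasSum hpt).trans ?_
  rw [tsum_mul_left]
  calc _ ≤ 2 ^ (r / 2) * sqBracket k ^ (-(r / 2)) * (A * B) :=
        mul_le_mul_of_nonneg_left hAB (mul_nonneg (by positivity)
          (Real.rpow_nonneg (sqBracket_pos k).le _))
    _ = _ := by ring

/-- The sharp projection onto frequencies `|k| ≤ N`. -/
noncomputable def lowPass (N : ℝ) (a : ℤ → ℂ) (k : ℤ) : ℂ := if |(k : ℝ)| ≤ N then a k else 0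

/-- The sharp projection onto frequencies `|k| > N`. -/
noncomputable def highPass (N : ℝ) (a : ℤ → ℂ) (k : ℤ) : ℂ := if |(k : ℝ)| ≤ N then 0 else a k

lemma lowPass_add_highPass (N : ℝ) (a : ℤ → ℂ) (k : ℤ) :
    a k = lowPass N a k + highPass N a k := by
  unfold lowPass highPass
  split_ifs <;> simp

lemma HsBound.lowPass {r t A : ℝ} {a : ℤ → ℂ} (h : HsBound t a A) (hrt : r ≤ t) (N : ℝ) :
    HsBound r (lowPass N a) A := by
  refine h.of_norm_le hrt fun k => ?_
  unfold _root_.lowPass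
  split_ifs <;> simp

lemma HsBound.highPass {t A N : ℝ} {a : ℤ → ℂ} (h : HsBound t a A) (hN : 1 ≤ N) :
    HsBound (t - 1 / 4) (highPass N a) (A * N ^ (-(1 / 4) : ℝ)) := by
  have hN0 : 0 < N := by linarith
  have hsq : (N ^ (-(1 / 4) : ℝ)) ^ 2 = (N ^ 2) ^ (-(1 / 4) : ℝ) := by
    rw [← Real.rpow_natCast, ← Real.rpow_natCast, ← Real.rpow_mul hN0.le, ← Real.rpow_mul hN0.le]
    norm_num
  refine HsBound.of_le (f := fun k => (N ^ (-(1 / 4) : ℝ)) ^ 2 * (sqBracket k ^ t * ‖a k‖ ^ 2))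
    (mul_nonneg h.1 (by positivity)) (fun k => ?_) (h.2.1.mul_left _) ?_
  · have h1 := Real.rpow_nonneg (sqBracket_pos k).le t
    unfold _root_.highPass
    split_ifs with hk
    · rw [norm_zero, zero_pow two_ne_zero, mul_zero]
      exact mul_nonneg (sq_nonneg _) (mul_nonneg h1 (sq_nonneg _))
    · rw [sub_eq_add_neg, Real.rpow_add (sqBracket_pos k), hsq]
      have h2 : sqBracket k ^ (-(1 / 4) : ℝ) ≤ (N ^ 2) ^ (-(1 / 4) : ℝ) :=
        Real.rpow_le_rpow_of_nonpos (by positivity) (sq_le_sqBracket hN0.le hk) (by norm_num)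
      calc _ = sqBracket k ^ (-(1 / 4) : ℝ) * (sqBracket k ^ t * ‖a k‖ ^ 2) := by ring
        _ ≤ _ := by gcongr
  · rw [tsum_mul_left, mul_pow, mul_comm]
    exact mul_le_mul_of_nonneg_right h.2.2 (sq_nonneg _)

lemma seqConv_add_left {a a₁ a₂ b : ℤ → ℂ} {k : ℤ} (ha : ∀ j, a j = a₁ j + a₂ j)
    (h₁ : Summable fun j => a₁ j * b (k - j)) (h₂ : Summable fun j => a₂ j * b (k - j)) :
    seqConv a b k = seqConv a₁ b k + seqConv a₂ b k := by
  unfold seqConv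
  rw [← h₁.tsum_add h₂]
  simp only [ha, add_mul]

lemma seqConv_add_right {a b b₁ b₂ : ℤ → ℂ} {k : ℤ} (hb : ∀ j, b j = b₁ j + b₂ j)
    (h₁ : Summable fun j => a j * b₁ (k - j)) (h₂ : Summable fun j => a j * b₂ (k - j)) :
    seqConv a b k = seqConv a b₁ k + seqConv a b₂ k := by
  unfold seqConv
  rw [← h₁.tsum_add h₂]
  simp only [hb, mul_add]

lemma seqConv_comm (a b : ℤ → ℂ) (k : ℤ) : seqConv a b k = seqConv b a k := by
  unfold seqConv
  rw [← (Equiv.subLeft k).tsum_eq]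
  simp [mul_comm]

lemma miura_sub {r A : ℝ} (hr : 0 ≤ r) {v w : ℤ → ℂ} (hv : HsBound r v A) (hw : HsBound r w A)
    {k : ℤ} (hk : k ≠ 0) : miura w k - miura v k =
      Complex.I * k * (w k - v k) + seqConv (fun j => w j + v j) (fun j => w j - v j) k := by
  have hd : HsBound r (fun j => w j - v j) (2 * A) :=
    hw.of_norm_le_add hv fun j => norm_sub_le _ _
  have h1 : seqConv (fun j => w j + v j) (fun j => w j - v j) k =
      seqConv w (fun j => w j - v j) k + seqConv v (fun j => w j - v j) k :=
    seqConv_add_left (fun _ => rfl) (hw.seqConv hr hd k).1 (hv.seqConv hr hd k).1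
  have h2 : seqConv w w k = seqConv w (fun j => w j - v j) k + seqConv w v k :=
    seqConv_add_right (fun _ => by ring) (hw.seqConv hr hd k).1 (hw.seqConv hr hv k).1
  have h3 : seqConv v w k = seqConv v (fun j => w j - v j) k + seqConv v v k :=
    seqConv_add_right (fun _ => by ring) (hv.seqConv hr hd k).1 (hv.seqConv hr hv k).1
  rw [miura, miura, if_neg hk, if_neg hk, h1, h2, seqConv_comm w v, h3]
  ring

lemma trigPoly_mul_trigPoly {S T : Finset ℤ} (hST : ∀ i ∈ S, ∀ j ∈ S, i + j ∈ T) {a b : ℤ → ℂ}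
    (ha : ∀ j ∉ S, a j = 0) (hb : ∀ j ∉ S, b j = 0) (x : ℝ) :
    trigPoly S a x * trigPoly S b x = trigPoly T (seqConv a b) x := by
  have h : ∀ k, seqConv a b k = ∑ i ∈ S, a i * b (k - i) := fun k =>
    tsum_eq_sum fun j hj => by rw [ha j hj, zero_mul]
  unfold trigPoly
  simp_rw [h, Finset.sum_mul]
  rw [Finset.sum_comm]
  refine Finset.sum_congr rfl fun i hi => ?_
  rw [Finset.mul_sum]
  refine Finset.sum_of_injOn (fun j => i + j) (fun _ _ _ _ h => add_left_cancel h)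
    (fun j hj => hST i hi j hj) (fun k _ hk => ?_) fun j _ => ?_
  · rw [hb (k - i) fun hmem => hk ⟨k - i, hmem, by simp⟩]
    simp
  · rw [add_sub_cancel_left]
    push_cast
    rw [mul_add, add_mul, Complex.exp_add]
    ring

/-- The Fourier coefficients at `|k| ≤ N` of a mean-zero solution of `P_{≤N}(u' + p u) = 0`
are uniformly small as `N` grows. -/
lemma exists_norm_coeff_le {t A : ℝ} (ht : 1 / 2 ≤ t) :
    ∃ C : ℝ, 0 ≤ C ∧ ∀ N : ℝ, 1 ≤ N → ∀ p u : ℤ → ℂ, IsRealSeq p → p 0 = 0 → u 0 = 0 →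
      HsBound t p A → HsBound t u A →
      (∀ k : ℤ, k ≠ 0 → |(k : ℝ)| ≤ N → Complex.I * k * u k + seqConv p u k = 0) →
      ∀ k : ℤ, |(k : ℝ)| ≤ N → ‖u k‖ ≤ C * N ^ (-(1 / 8) : ℝ) := by
  set r := t - 1 / 4 with hr
  have hr0 : 0 ≤ r := by linarith
  have hrt : r ≤ t := by linarith
  have hκ := summable_sqBracket_rpow (q := 9 / 16) (by norm_num)
  have hκ1 := summable_sqBracket_rpow (q := 1) (by norm_num)
  set B := A ^ 2 + ∑' k : ℤ, sqBracket k ^ (-1 : ℝ) with hBdef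
  set L := 2 ^ (r / 2) * A ^ 2 with hL
  have hL0 : 0 ≤ L := by positivity
  set κ := ∑' k : ℤ, sqBracket k ^ (-(9 / 16) : ℝ) with hκdef
  have hκ0 : 0 ≤ κ := tsum_nonneg fun k => Real.rpow_nonneg (sqBracket_pos k).le _
  refine ⟨(exp B * ((exp (2 * B) + 1) * ((exp (3 * B) + exp B) * (π * (1 + A ^ 2)))) + 1) *
    (4 * L * κ), by positivity, ?_⟩
  intro N hN p u hp hp0 hu0 hpA huA heq k hk
  have hN0 : 0 < N := by linarith
  set pL := lowPass N p with hpL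
  set uL := lowPass N u with huL
  have hpLA : HsBound r pL A := hpA.lowPass hrt N
  have huLA : HsBound r uL A := huA.lowPass hrt N
  have huA' : HsBound r u A := huA.of_norm_le hrt fun _ => le_rfl
  have hpA' : HsBound r p A := hpA.of_norm_le hrt fun _ => le_rfl
  have hpH := hpA.highPass hN
  have huH := huA.highPass hN
  set m := ⌊N⌋ with hm
  set S := Finset.Icc (-m) m with hSdef
  set T := Finset.Icc (-(2 * m)) (2 * m) with hTdef
  have hmem : ∀ j : ℤ, j ∈ S ↔ |(j : ℝ)| ≤ N := by
    intro j
    rw [hSdef, Finset.mem_Icc, ← abs_le, hm, Int.le_floor]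
    push_cast
    rfl
  have hm0 : 0 ≤ m := Int.floor_nonneg.2 hN0.le
  have hST : S ⊆ T := Finset.Icc_subset_Icc (by omega) (by omega)
  have hneg : ∀ j ∈ S, -j ∈ S := fun j hj => by
    rw [hmem] at hj ⊢; push_cast; rwa [abs_neg]
  have hpLS : ∀ j ∉ S, pL j = 0 := fun j hj => if_neg ((hmem j).not.1 hj)
  have huLS : ∀ j ∉ S, uL j = 0 := fun j hj => if_neg ((hmem j).not.1 hj)
  have hpLS' : ∀ j ∈ S, pL j = p j := fun j hj => if_pos ((hmem j).1 hj)
  have huLS' : ∀ j ∈ S, uL j = u j := fun j hj => if_pos ((hmem j).1 hj)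
  set F : ℤ → ℂ := fun j => if j = 0 then 0 else Complex.I * j * uL j + seqConv pL uL j with hF
  set G : ℤ → ℂ := fun j => F j / (Complex.I * j) with hG
  have hG0 : G 0 = 0 := by simp [hG]
  have hFG : ∀ j : ℤ, Complex.I * j * G j = F j := by
    intro j
    rcases eq_or_ne j 0 with rfl | hj
    · simp [hF]
    · have : (j : ℂ) ≠ 0 := by exact_mod_cast hj
      simp only [hG]
      field_simp
  have hFbound : ∀ j, j ≠ 0 → ‖F j‖ ≤ 2 * L * (if |(j : ℝ)| ≤ N then N ^ (-(1 / 4) : ℝ) else 1) *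
      sqBracket j ^ (-(r / 2)) := by
    intro j hj
    have hJ := Real.rpow_nonneg (sqBracket_pos j).le (-(r / 2))
    simp only [hF, if_neg hj]
    split_ifs with hjN
    · have h1 : seqConv p u j = seqConv p uL j + seqConv p (highPass N u) j :=
        seqConv_add_right (lowPass_add_highPass N u) (hpA'.seqConv hr0 huLA j).1
          (hpA'.seqConv hr0 huH j).1
      have h2 : seqConv p uL j = seqConv pL uL j + seqConv (highPass N p) uL j :=
        seqConv_add_left (lowPass_add_highPass N p) (hpLA.seqConv hr0 huLA j).1
          (hpH.seqConv hr0 huLA j).1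
      have h3 : Complex.I * j * uL j + seqConv pL uL j =
          -(seqConv p (highPass N u) j + seqConv (highPass N p) uL j) := by
        rw [huLS' j ((hmem j).2 hjN)]
        linear_combination heq j hj hjN - h1 - h2
      rw [h3, norm_neg]
      refine (norm_add_le _ _).trans ((add_le_add (hpA'.seqConv hr0 huH j).2
        (hpH.seqConv hr0 huLA j).2).trans (le_of_eq ?_))
      rw [hL]
      ring
    · rw [huL, lowPass, if_neg hjN, mul_zero, zero_add]
      refine (hpLA.seqConv hr0 huLA j).2.trans ?_
      rw [hL]
      have : 0 ≤ 2 ^ (r / 2) * A ^ 2 * sqBracket j ^ (-(r / 2)) := mul_nonneg hL0 hJ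
      linarith
  have hGbound : ∀ j, ‖G j‖ ≤ 4 * L * N ^ (-(1 / 8) : ℝ) * sqBracket j ^ (-(9 / 16) : ℝ) := by
    intro j
    have hJ := sqBracket_pos j
    have hJ9 := Real.rpow_nonneg hJ.le (-(9 / 16))
    rcases eq_or_ne j 0 with rfl | hj
    · rw [hG0, norm_zero]
      positivity
    have h1 : ‖G j‖ = |(j : ℝ)|⁻¹ * ‖F j‖ := by
      simp only [hG, norm_div, norm_mul, Complex.norm_I, one_mul, Complex.norm_intCast]
      rw [div_eq_inv_mul]
    have h2 : (if |(j : ℝ)| ≤ N then N ^ (-(1 / 4) : ℝ) else 1) *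
        (sqBracket j ^ (-(1 / 2) : ℝ) * sqBracket j ^ (-(r / 2))) ≤
        N ^ (-(1 / 8) : ℝ) * sqBracket j ^ (-(9 / 16) : ℝ) := by
      rw [← Real.rpow_add hJ]
      split_ifs with hjN
      · exact mul_le_mul (Real.rpow_le_rpow_of_exponent_le hN (by norm_num))
          (Real.rpow_le_rpow_of_exponent_le (one_le_sqBracket j) (by linarith))
          (Real.rpow_nonneg hJ.le _) (by positivity)
      · rw [one_mul]
        calc sqBracket j ^ (-(1 / 2) + -(r / 2) : ℝ)
            ≤ sqBracket j ^ (-(1 / 16) + -(9 / 16) : ℝ) :=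
              Real.rpow_le_rpow_of_exponent_le (one_le_sqBracket j) (by linarith)
          _ = sqBracket j ^ (-(1 / 16) : ℝ) * sqBracket j ^ (-(9 / 16) : ℝ) := Real.rpow_add hJ _ _
          _ ≤ (N ^ 2) ^ (-(1 / 16) : ℝ) * sqBracket j ^ (-(9 / 16) : ℝ) :=
              mul_le_mul_of_nonneg_right (Real.rpow_le_rpow_of_nonpos (by positivity)
                (sq_le_sqBracket hN0.le hjN) (by norm_num)) hJ9
          _ = _ := by
              rw [← Real.rpow_natCast, ← Real.rpow_mul hN0.le]
              norm_num
    rw [h1]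
    calc |(j : ℝ)|⁻¹ * ‖F j‖ ≤ (2 * sqBracket j ^ (-(1 / 2) : ℝ)) * (2 * L *
          (if |(j : ℝ)| ≤ N then N ^ (-(1 / 4) : ℝ) else 1) * sqBracket j ^ (-(r / 2))) :=
          mul_le_mul (inv_abs_le_sqBracket hj) (hFbound j hj) (norm_nonneg _)
            (mul_nonneg zero_le_two (Real.rpow_nonneg hJ.le _))
      _ = 4 * L * ((if |(j : ℝ)| ≤ N then N ^ (-(1 / 4) : ℝ) else 1) *
        (sqBracket j ^ (-(1 / 2) : ℝ) * sqBracket j ^ (-(r / 2)))) := by ring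
      _ ≤ 4 * L * (N ^ (-(1 / 8) : ℝ) * sqBracket j ^ (-(9 / 16) : ℝ)) := by gcongr
      _ = _ := by ring
  have hode : ∀ x, trigPoly S (fun j => Complex.I * j * uL j) x + trigPoly S pL x * trigPoly S uL x =
      seqConv pL uL 0 + trigPoly T (fun j => Complex.I * j * G j) x := by
    intro x
    rw [trigPoly_mul_trigPoly (T := T) (fun i hi j hj => ?_) hpLS huLS]
    · have h1 : trigPoly S (fun j => Complex.I * j * uL j) x =
          trigPoly T (fun j => Complex.I * j * uL j) x :=
        Finset.sum_subset hST fun j _ hj => by simp [huLS j hj]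
      have h2 : seqConv pL uL 0 =
          trigPoly T (fun j => if j = 0 then seqConv pL uL 0 else 0) x := by
        unfold trigPoly
        rw [Finset.sum_eq_single_of_mem 0 (by rw [hTdef, Finset.mem_Icc]; omega)
          fun j _ hj => by simp [hj]]
        simp
      rw [h1, h2]
      unfold trigPoly
      rw [← Finset.sum_add_distrib, ← Finset.sum_add_distrib]
      refine Finset.sum_congr rfl fun j _ => ?_
      simp only [hFG, hF]
      split_ifs with hj
      · simp [hj]
      · ring
    · rw [hSdef, Finset.mem_Icc] at hi hj
      rw [hTdef, Finset.mem_Icc]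
      omega
  have hpLreal : IsRealSeq pL := by
    intro j
    simp only [hpL, lowPass, Int.cast_neg, abs_neg]
    split_ifs
    · exact hp j
    · simp
  have hQ' : ∀ j, ‖pL j‖ ^ 2 ≤ sqBracket j ^ t * ‖pL j‖ ^ 2 := fun j =>
    le_mul_of_one_le_left (sq_nonneg _) (Real.one_le_rpow (one_le_sqBracket j) (by linarith))
  have hpLt := hpA.lowPass le_rfl N
  have hQ : ∑ j ∈ S, ‖pL j‖ ^ 2 ≤ A ^ 2 :=
    (Finset.sum_le_sum fun j _ => hQ' j).trans ((hpLt.2.1.sum_le_tsum S fun j _ =>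
      mul_nonneg (Real.rpow_nonneg (sqBracket_pos j).le _) (sq_nonneg _)).trans hpLt.2.2)
  have hB : ∑ j ∈ S, ‖pL j / (Complex.I * j)‖ ≤ B := by
    have h1 : ∀ j, ‖pL j / (Complex.I * j)‖ ≤ ‖pL j‖ ^ 2 + sqBracket j ^ (-1 : ℝ) := by
      intro j
      have hJ := Real.rpow_nonneg (sqBracket_pos j).le (-1)
      rcases eq_or_ne j 0 with rfl | hj
      · simp only [Int.cast_zero, mul_zero, div_zero, norm_zero]
        positivity
      · have h2 := inv_abs_le_sqBracket hj
        have h3 : sqBracket j ^ (-1 : ℝ) = (sqBracket j ^ (-(1 / 2) : ℝ)) ^ 2 := by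
          rw [← Real.rpow_natCast, ← Real.rpow_mul (sqBracket_pos j).le]
          norm_num
        simp only [norm_div, norm_mul, Complex.norm_I, one_mul, Complex.norm_intCast]
        rw [div_eq_mul_inv, h3]
        have h4 := mul_le_mul_of_nonneg_left h2 (norm_nonneg (pL j))
        nlinarith [sq_nonneg (‖pL j‖ - sqBracket j ^ (-(1 / 2) : ℝ))]
    refine (Finset.sum_le_sum fun j _ => h1 j).trans ?_
    rw [Finset.sum_add_distrib]
    exact add_le_add hQ (hκ1.sum_le_tsum S fun j _ => Real.rpow_nonneg (sqBracket_pos j).le _)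
  have hg : ∑ j ∈ T, ‖G j‖ ≤ 4 * L * N ^ (-(1 / 8) : ℝ) * κ := by
    refine (Finset.sum_le_sum fun j _ => hGbound j).trans ?_
    rw [← Finset.mul_sum]
    gcongr
    exact hκ.sum_le_tsum T fun j _ => Real.rpow_nonneg (sqBracket_pos j).le _
  have hkS := (hmem k).2 hk
  have hfin := norm_coeff_le_of_trigPoly_ode hneg hpLreal
    (by rw [hpLS' 0 ((hmem 0).2 (by simpa using hN0.le)), hp0])
    (by rw [huLS' 0 ((hmem 0).2 (by simpa using hN0.le)), hu0]) hG0 hode hB hQ hg hkS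
  rw [huLS' k hkS] at hfin
  exact hfin.trans (le_of_eq (by ring))

/-- Interpolation: small low frequency coefficients and a bound in `H^t` give smallness in
`H^{t-1/4}`. -/
lemma HsBound.lowPass_of_coeff_le {t A C N : ℝ} (ht : 1 / 2 ≤ t) (hN : 1 ≤ N) {u : ℤ → ℂ}
    (hu : HsBound t u A)
    (hC : ∀ k : ℤ, |(k : ℝ)| ≤ N → ‖u k‖ ≤ C * N ^ (-(1 / 8) : ℝ)) :
    HsBound (t - 1 / 4) (_root_.lowPass N u)
      (√(A ^ 2 + C ^ 2 * ∑' k : ℤ, sqBracket k ^ (-1 : ℝ)) *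
        N ^ (-(1 / (64 * (t + 3 / 4))) : ℝ)) := by
  have hN0 : 0 < N := by linarith
  have hκ1 := summable_sqBracket_rpow (q := 1) (by norm_num)
  have hκ0 : 0 ≤ ∑' k : ℤ, sqBracket k ^ (-1 : ℝ) :=
    tsum_nonneg fun k => Real.rpow_nonneg (sqBracket_pos k).le _
  have ht' : 0 < t + 3 / 4 := by linarith
  set e := 1 / (8 * (t + 3 / 4)) with he
  have he0 : 0 < e := by positivity
  have he1 : e ≤ 1 / 8 := by
    rw [he]
    exact one_div_le_one_div_of_le (by norm_num) (by linarith)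
  have het : e * (t + 3 / 4) = 1 / 8 := by rw [he]; field_simp
  have hsq : (N ^ (-(1 / (64 * (t + 3 / 4))) : ℝ)) ^ 2 = N ^ (-(e / 4)) := by
    rw [← Real.rpow_natCast, ← Real.rpow_mul hN0.le]
    congr 1
    rw [he]
    field_simp
    norm_num
  refine HsBound.of_le (f := fun k => N ^ (-(e / 4)) * (sqBracket k ^ t * ‖u k‖ ^ 2 +
      C ^ 2 * sqBracket k ^ (-1 : ℝ))) (by positivity) (fun k => ?_)
    ((hu.2.1.add (hκ1.mul_left _)).mul_left _) ?_
  · have hJ := sqBracket_pos k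
    have hJt := Real.rpow_nonneg hJ.le t
    have hJ1 := Real.rpow_nonneg hJ.le (-1)
    have hNe : 0 ≤ N ^ (-(e / 4)) := by positivity
    unfold _root_.lowPass
    split_ifs with hk
    · rcases le_total (N ^ e) (sqBracket k) with hl | hl
      · have h1 : sqBracket k ^ (-(1 / 4) : ℝ) ≤ N ^ (-(e / 4)) := by
          calc sqBracket k ^ (-(1 / 4) : ℝ) ≤ (N ^ e) ^ (-(1 / 4) : ℝ) :=
                Real.rpow_le_rpow_of_nonpos (by positivity) hl (by norm_num)
            _ = _ := by rw [← Real.rpow_mul hN0.le]; ring_nf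
        rw [sub_eq_add_neg, Real.rpow_add hJ]
        calc _ = sqBracket k ^ (-(1 / 4) : ℝ) * (sqBracket k ^ t * ‖u k‖ ^ 2) := by ring
          _ ≤ N ^ (-(e / 4)) * (sqBracket k ^ t * ‖u k‖ ^ 2) := by gcongr
          _ ≤ _ := by
            gcongr
            exact le_add_of_nonneg_right (by positivity)
      · have h1 : sqBracket k ^ (t - 1 / 4) ≤ N ^ (1 / 8 : ℝ) * sqBracket k ^ (-1 : ℝ) := by
          calc sqBracket k ^ (t - 1 / 4) = sqBracket k ^ (t + 3 / 4) * sqBracket k ^ (-1 : ℝ) := by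
                rw [← Real.rpow_add hJ]; ring_nf
            _ ≤ (N ^ e) ^ (t + 3 / 4) * sqBracket k ^ (-1 : ℝ) := by
                gcongr
            _ = _ := by rw [← Real.rpow_mul hN0.le, het]
        have h2 : ‖u k‖ ^ 2 ≤ C ^ 2 * N ^ (-(1 / 4) : ℝ) := by
          calc ‖u k‖ ^ 2 ≤ (C * N ^ (-(1 / 8) : ℝ)) ^ 2 := by gcongr; exact hC k hk
            _ = _ := by
              rw [mul_pow, ← Real.rpow_natCast (N ^ (-(1 / 8) : ℝ)), ← Real.rpow_mul hN0.le]
              norm_num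
        calc sqBracket k ^ (t - 1 / 4) * ‖u k‖ ^ 2
            ≤ (N ^ (1 / 8 : ℝ) * sqBracket k ^ (-1 : ℝ)) * (C ^ 2 * N ^ (-(1 / 4) : ℝ)) :=
              mul_le_mul h1 h2 (sq_nonneg _) (by positivity)
          _ = (N ^ (1 / 8 : ℝ) * N ^ (-(1 / 4) : ℝ)) * (C ^ 2 * sqBracket k ^ (-1 : ℝ)) := by ring
          _ ≤ N ^ (-(e / 4)) * (C ^ 2 * sqBracket k ^ (-1 : ℝ)) := by
              rw [← Real.rpow_add hN0]
              gcongr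
              linarith
          _ ≤ _ := by
            gcongr
            exact le_add_of_nonneg_left (by positivity)
    · rw [norm_zero, zero_pow two_ne_zero, mul_zero]
      positivity
  · rw [tsum_mul_left, hu.2.1.tsum_add (hκ1.mul_left _), tsum_mul_left, mul_pow, hsq,
      Real.sq_sqrt (by positivity), mul_comm]
    gcongr
    exact hu.2.2

/-- Frequencies `|k| ≤ N` of a mean-zero solution of `P_{≤N}(u' + p u) = 0` decay in `H^t`
at a polynomial rate in `N`. -/
lemma exists_hsBound_lowPass {t A : ℝ} (ht : 1 / 2 ≤ t) (hA : 0 ≤ A) :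
    ∃ σ C : ℝ, 0 < σ ∧ 0 < C ∧ ∀ N : ℝ, 1 ≤ N → ∀ p u : ℤ → ℂ, IsRealSeq p → p 0 = 0 → u 0 = 0 →
      HsBound t p A → HsBound t u A →
      (∀ k : ℤ, k ≠ 0 → |(k : ℝ)| ≤ N → Complex.I * k * u k + seqConv p u k = 0) →
      HsBound t (lowPass N u) (C * N ^ (-σ)) := by
  obtain ⟨C₀, hC₀, hcoeff⟩ := exists_norm_coeff_le (A := A) ht
  set r := t - 1 / 4 with hr
  have hr0 : 0 ≤ r := by linarith
  have hrt : r ≤ t := by linarith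
  have hκ := summable_sqBracket_rpow (q := 3 / 4) (by norm_num)
  set κ := ∑' k : ℤ, sqBracket k ^ (-(3 / 4) : ℝ) with hκdef
  have hκ0 : 0 ≤ κ := tsum_nonneg fun k => Real.rpow_nonneg (sqBracket_pos k).le _
  set D := √(A ^ 2 + C₀ ^ 2 * ∑' k : ℤ, sqBracket k ^ (-1 : ℝ)) with hD
  set σ := 1 / (64 * (t + 3 / 4)) with hσ
  have hσ0 : 0 < σ := by
    have : 0 < t + 3 / 4 := by linarith
    positivity
  have hσ1 : σ ≤ 1 / 4 := one_div_le_one_div_of_le (by norm_num) (by linarith)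
  set E := 2 * (2 ^ (r / 2) * (A * (D + A))) with hE
  have hE0 : 0 ≤ E := by positivity
  refine ⟨σ, E * √κ + 1, hσ0, by positivity, ?_⟩
  intro N hN p u hp hp0 hu0 hpA huA heq
  have hN0 : 0 < N := by linarith
  have huL : HsBound r (lowPass N u) (D * N ^ (-σ)) :=
    huA.lowPass_of_coeff_le ht hN (hcoeff N hN p u hp hp0 hu0 hpA huA heq)
  have huH := huA.highPass hN
  have hpA' : HsBound r p A := hpA.of_norm_le hrt fun _ => le_rfl
  have hpt : ∀ k : ℤ, ‖lowPass N u k‖ ≤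
      E * N ^ (-σ) * (sqBracket k ^ (-(1 / 2) : ℝ) * sqBracket k ^ (-(r / 2))) := by
    intro k
    have hJ := sqBracket_pos k
    have hJ1 := Real.rpow_nonneg hJ.le (-(1 / 2))
    have hJ2 := Real.rpow_nonneg hJ.le (-(r / 2))
    unfold lowPass
    split_ifs with hk
    · rcases eq_or_ne k 0 with rfl | hk0
      · rw [hu0, norm_zero]
        positivity
      have h1 : seqConv p u k = seqConv p (lowPass N u) k + seqConv p (highPass N u) k :=
        seqConv_add_right (lowPass_add_highPass N u) (hpA'.seqConv hr0 huL k).1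
          (hpA'.seqConv hr0 huH k).1
      have h2 : ‖seqConv p u k‖ ≤ 2 ^ (r / 2) * (A * (D + A)) * N ^ (-σ) *
          sqBracket k ^ (-(r / 2)) := by
        rw [h1]
        have h3 : N ^ (-(1 / 4) : ℝ) ≤ N ^ (-σ) :=
          Real.rpow_le_rpow_of_exponent_le hN (by linarith)
        calc _ ≤ 2 ^ (r / 2) * (A * (D * N ^ (-σ))) * sqBracket k ^ (-(r / 2)) +
              2 ^ (r / 2) * (A * (A * N ^ (-(1 / 4) : ℝ))) * sqBracket k ^ (-(r / 2)) :=
              (norm_add_le _ _).trans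
                (add_le_add (hpA'.seqConv hr0 huL k).2 (hpA'.seqConv hr0 huH k).2)
          _ ≤ 2 ^ (r / 2) * (A * (D * N ^ (-σ))) * sqBracket k ^ (-(r / 2)) +
              2 ^ (r / 2) * (A * (A * N ^ (-σ))) * sqBracket k ^ (-(r / 2)) := by gcongr
          _ = _ := by ring
      have h4 : |(k : ℝ)| * ‖u k‖ = ‖seqConv p u k‖ := by
        rw [← norm_neg (seqConv p u k), ← eq_neg_of_add_eq_zero_left (heq k hk0 hk)]
        simp
      have h5 : 0 < |(k : ℝ)| := one_pos.trans_le (one_le_abs_intCast hk0)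
      calc ‖u k‖ = |(k : ℝ)|⁻¹ * ‖seqConv p u k‖ := by rw [← h4]; field_simp
        _ ≤ (2 * sqBracket k ^ (-(1 / 2) : ℝ)) * (2 ^ (r / 2) * (A * (D + A)) * N ^ (-σ) *
          sqBracket k ^ (-(r / 2))) :=
            mul_le_mul (inv_abs_le_sqBracket hk0) h2 (norm_nonneg _) (by positivity)
        _ = _ := by rw [hE]; ring
    · rw [norm_zero]
      positivity
  refine HsBound.of_le (f := fun k => (E * N ^ (-σ)) ^ 2 * sqBracket k ^ (-(3 / 4) : ℝ))
    (by positivity) (fun k => ?_) (hκ.mul_left _) ?_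
  · have hJ := sqBracket_pos k
    have h1 : sqBracket k ^ t * (sqBracket k ^ (-(1 / 2) : ℝ) * sqBracket k ^ (-(r / 2))) ^ 2 =
        sqBracket k ^ (-(3 / 4) : ℝ) := by
      rw [← Real.rpow_add hJ, ← Real.rpow_natCast, ← Real.rpow_mul hJ.le, ← Real.rpow_add hJ]
      congr 1
      push_cast
      rw [hr]
      ring
    calc sqBracket k ^ t * ‖lowPass N u k‖ ^ 2 ≤ sqBracket k ^ t *
          (E * N ^ (-σ) * (sqBracket k ^ (-(1 / 2) : ℝ) * sqBracket k ^ (-(r / 2)))) ^ 2 :=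
          mul_le_mul_of_nonneg_left (by gcongr; exact hpt k) (Real.rpow_nonneg hJ.le _)
      _ = _ := by rw [← h1]; ring
  · rw [tsum_mul_left]
    calc (E * N ^ (-σ)) ^ 2 * κ = (E * √κ * N ^ (-σ)) ^ 2 := by
          rw [mul_pow, mul_pow _ (N ^ (-σ)), mul_pow E, Real.sq_sqrt hκ0]; ring
      _ ≤ _ := by
        gcongr
        linarith

end

/-- Lemma 5.1 (v-disc): if `v₀, ṽ₀ ∈ H^{s+1}₀(𝕋)` have norms at most `R` and their Miura
transforms agree at frequencies `|k| ≤ N'`, then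
`‖P_{≤N'}(ṽ₀ - v₀)‖_{H^{s+1}₀} ≤ C (N')^{-σ}` for some `σ > 0` and `C = C(s, R)`. -/
theorem miura_low_frequency_agreement (s : ℝ) (hs : -(1 / 2) ≤ s) (R : ℝ) (hR : 0 < R) :
    ∃ σ C : ℝ, 0 < σ ∧ 0 < C ∧
      ∀ N' : ℝ, 1 ≤ N' → ∀ v₀ w₀ : ℤ → ℂ,
        IsRealSeq v₀ → v₀ 0 = 0 → InHs (s + 1) v₀ → hsNorm (s + 1) v₀ ≤ R →
        IsRealSeq w₀ → w₀ 0 = 0 → InHs (s + 1) w₀ → hsNorm (s + 1) w₀ ≤ R →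
        (∀ k : ℤ, |(k : ℝ)| ≤ N' → miura w₀ k = miura v₀ k) →
        hsNorm (s + 1) (fun k : ℤ => if |(k : ℝ)| ≤ N' then w₀ k - v₀ k else 0) ≤
          C * N' ^ (-σ) := by
  obtain ⟨σ, C, hσ, hC, H⟩ :=
    exists_hsBound_lowPass (t := s + 1) (A := 2 * R) (by linarith) (by linarith)
  refine ⟨σ, C, hσ, hC, ?_⟩
  intro N hN v w hv hv0 hvs hvR hw hw0 hws hwR hM
  have hvB := HsBound.of_hsNorm_le hvs hvR
  have hwB := HsBound.of_hsNorm_le hws hwR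
  refine (H N hN (fun k => w k + v k) (fun k => w k - v k) (fun k => ?_) (by simp [hv0, hw0])
    (by simp [hv0, hw0]) (hwB.of_norm_le_add hvB fun k => norm_add_le _ _)
    (hwB.of_norm_le_add hvB fun k => norm_sub_le _ _) fun k hk hkN => ?_).hsNorm_le
  · simp only [map_add, hv k, hw k]
  · rw [← miura_sub (by linarith) hvB hwB hk, hM k hkN, sub_self]
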